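/- arXiv:1111.6146 — 2 statements merged into one kernel-verified Lean document; each statement's English description precedes it below -/
import Mathlib

section
/- Let w ∈ S_n be defined by inclusions and let (p,q) ∈ E(w) with r_w(p,q) > 0. Then p ≤ q and r_w(p,q) = q − p + 1. -/
/-- One-line notation value of a permutation of `Fin n` at a position `k ∈ {1,…,n}`;
junk value `0` outside that range. -/
def pval {n : ℕ} (w : Equiv.Perm (Fin n)) (k : ℕ) : ℕ :=
  if h : 1 ≤ k ∧ k ≤ n then ((w ⟨k - 1, by omega⟩ : Fin n) : ℕ) + 1 else 0

/-- The rank function `r_w(p,q) = #{k ≤ q : w(k) ≥ p}`. -/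
def rk {n : ℕ} (w : Equiv.Perm (Fin n)) (p q : ℕ) : ℕ :=
  ((Finset.Icc 1 n).filter fun k => k ≤ q ∧ p ≤ pval w k).card

/-- The Rothe diagram `D(w) = {(p,q) ∈ {1,…,n}² : w(q) < p and w⁻¹(p) > q}`. -/
def Diagram {n : ℕ} (w : Equiv.Perm (Fin n)) : Set (ℕ × ℕ) :=
  {pq | 1 ≤ pq.1 ∧ pq.1 ≤ n ∧ 1 ≤ pq.2 ∧ pq.2 ≤ n ∧
    pval w pq.2 < pq.1 ∧ pq.2 < pval w.symm pq.1}

/-- The essential set `E(w)`. -/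
def EssSet {n : ℕ} (w : Equiv.Perm (Fin n)) : Set (ℕ × ℕ) :=
  {pq | pq ∈ Diagram w ∧ (pq.1, pq.2 + 1) ∉ Diagram w ∧ (pq.1 - 1, pq.2) ∉ Diagram w}

/-- Condition A at `(p,q)`: there is no `k` with `k ≤ q` and `w(k) ≥ p`. -/
def CondA {n : ℕ} (w : Equiv.Perm (Fin n)) (p q : ℕ) : Prop :=
  ¬ ∃ k, 1 ≤ k ∧ k ≤ n ∧ k ≤ q ∧ p ≤ pval w k

/-- Condition B at `(p,q)`: there is no `k` with `k > q` and `w(k) < p`. -/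
def CondB {n : ℕ} (w : Equiv.Perm (Fin n)) (p q : ℕ) : Prop :=
  ¬ ∃ k, 1 ≤ k ∧ k ≤ n ∧ q < k ∧ pval w k < p

/-- `w` is defined by inclusions if every essential set box satisfies Condition A or B. -/
def DefinedByInclusions {n : ℕ} (w : Equiv.Perm (Fin n)) : Prop :=
  ∀ p q, (p, q) ∈ EssSet w → CondA w p q ∨ CondB w p q

theorem pval_mem_Icc {n : ℕ} (w : Equiv.Perm (Fin n)) {k : ℕ} (hk : k ∈ Finset.Icc 1 n) :
    pval w k ∈ Finset.Icc 1 n := by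
  rw [Finset.mem_Icc] at hk ⊢
  rw [pval, dif_pos hk]
  omega

theorem pval_symm_pval {n : ℕ} (w : Equiv.Perm (Fin n)) {k : ℕ} (hk : k ∈ Finset.Icc 1 n) :
    pval w.symm (pval w k) = k := by
  have hv := pval_mem_Icc w hk
  rw [Finset.mem_Icc] at hk hv
  rw [pval, dif_pos hv]
  simp only [pval, dif_pos hk, Nat.add_sub_cancel, Fin.eta, Equiv.symm_apply_apply]
  omega

theorem card_filter_pval_lt {n : ℕ} (w : Equiv.Perm (Fin n)) {p : ℕ} (hp : p ≤ n) :
    ((Finset.Icc 1 n).filter fun k => pval w k < p).card = p - 1 := by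
  have hcard : (Finset.Ico 1 p).card = p - 1 := Nat.card_Ico 1 p
  rw [← hcard]
  have hsub : ∀ k ∈ Finset.Ico 1 p, k ∈ Finset.Icc 1 n := by
    intro k hk
    rw [Finset.mem_Ico] at hk
    rw [Finset.mem_Icc]
    omega
  refine Finset.card_nbij' (pval w) (pval w.symm) ?_ ?_ ?_ ?_
  · intro k hk
    obtain ⟨hk, hlt⟩ := Finset.mem_filter.1 hk
    exact Finset.mem_Ico.2 ⟨(Finset.mem_Icc.1 (pval_mem_Icc w hk)).1, hlt⟩
  · intro k hk
    have hk' := hsub k hk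
    refine Finset.mem_filter.2 ⟨pval_mem_Icc _ hk', ?_⟩
    have h := pval_symm_pval w.symm hk'
    rw [Equiv.symm_symm] at h
    rw [h]
    exact (Finset.mem_Ico.1 hk).2
  · intro k hk
    exact pval_symm_pval w (Finset.mem_filter.1 hk).1
  · intro k hk
    simpa using pval_symm_pval w.symm (hsub k hk)

theorem rk_add_of_condB {n : ℕ} (w : Equiv.Perm (Fin n)) {p q : ℕ} (hp : p ≤ n) (hq : q ≤ n)
    (hB : CondB w p q) : rk w p q + (p - 1) = q := by
  have hlt : ((Finset.Icc 1 n).filter fun k => pval w k < p) =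
      (Finset.Icc 1 q).filter fun k => ¬ p ≤ pval w k := by
    ext k
    simp only [Finset.mem_filter, Finset.mem_Icc, not_le]
    constructor
    · rintro ⟨⟨h1, h2⟩, h3⟩
      exact ⟨⟨h1, not_lt.1 fun h => hB ⟨k, h1, h2, h, h3⟩⟩, h3⟩
    · rintro ⟨⟨h1, h2⟩, h3⟩
      exact ⟨⟨h1, h2.trans hq⟩, h3⟩
  have hge : ((Finset.Icc 1 n).filter fun k => k ≤ q ∧ p ≤ pval w k) =
      (Finset.Icc 1 q).filter fun k => p ≤ pval w k := by
    ext k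
    simp only [Finset.mem_filter, Finset.mem_Icc]
    constructor
    · rintro ⟨⟨h1, _⟩, h2, h3⟩
      exact ⟨⟨h1, h2⟩, h3⟩
    · rintro ⟨⟨h1, h2⟩, h3⟩
      exact ⟨⟨h1, h2.trans hq⟩, h2, h3⟩
  rw [← card_filter_pval_lt w hp, rk, hlt, hge, Finset.card_filter_add_card_filter_not,
    Nat.card_Icc, Nat.add_sub_cancel]

/-- If `w` is defined by inclusions and `(p,q) ∈ E(w)` has `r_w(p,q) > 0`,
then `p ≤ q` and `r_w(p,q) = q − p + 1`. -/
theorem essential_box_rank_of_definedByInclusions {n : ℕ} (w : Equiv.Perm (Fin n))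
    (hw : DefinedByInclusions w) {p q : ℕ} (hpq : (p, q) ∈ EssSet w)
    (hr : 0 < rk w p q) :
    p ≤ q ∧ rk w p q = q - p + 1 := by
  obtain ⟨⟨hp1 : 1 ≤ p, hpn : p ≤ n, _, hqn : q ≤ n, _⟩, _⟩ := id hpq
  have hA : ¬ CondA w p q := by
    obtain ⟨k, hk⟩ := Finset.card_pos.1 hr
    obtain ⟨hk, hkq, hpk⟩ := Finset.mem_filter.1 hk
    obtain ⟨h1, h2⟩ := Finset.mem_Icc.1 hk
    exact not_not_intro ⟨k, h1, h2, hkq, hpk⟩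
  have h := rk_add_of_condB w hpn hqn ((hw p q hpq).resolve_left hA)
  omega
end

section
/- Let w ∈ S_n be defined by inclusions and let (p,q) and (p′,q′) be two distinct boxes of E′(w). Then either p < p′ and q < q′, or p > p′ and q > q′. -/
theorem pval_symm_mem_Icc {n : ℕ} (w : Equiv.Perm (Fin n)) {p : ℕ} (hp : 1 ≤ p ∧ p ≤ n) :
    1 ≤ pval w.symm p ∧ pval w.symm p ≤ n := by
  simp only [pval, dif_pos hp]
  omega

theorem pval_pval_symm {n : ℕ} (w : Equiv.Perm (Fin n)) {p : ℕ} (hp : 1 ≤ p ∧ p ≤ n) :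
    pval w (pval w.symm p) = p := by
  have hk := pval_symm_mem_Icc w hp
  rw [pval, dif_pos hk]
  simp only [pval, dif_pos hp, Nat.add_sub_cancel, Fin.eta, Equiv.apply_symm_apply]
  omega

theorem not_condA_of_rk_pos {n : ℕ} {w : Equiv.Perm (Fin n)} {p q : ℕ} (h : 0 < rk w p q) :
    ¬ CondA w p q := by
  obtain ⟨k, hk⟩ := Finset.card_pos.mp h
  simp only [Finset.mem_filter, Finset.mem_Icc] at hk
  exact not_not_intro ⟨k, hk.1.1, hk.1.2, hk.2⟩

theorem CondB.lt_of_lt {n : ℕ} {w : Equiv.Perm (Fin n)} {p q p' q' : ℕ}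
    (hB : CondB w p' q') (hD : (p, q) ∈ Diagram w) (hlt : p < p') : q < q' := by
  obtain ⟨hp1, hpn, -, -, -, hq⟩ := hD
  have hk := pval_symm_mem_Icc w ⟨hp1, hpn⟩
  by_contra! hle
  exact hB ⟨_, hk.1, hk.2, hle.trans_lt hq, (pval_pval_symm w ⟨hp1, hpn⟩).trans_lt hlt⟩

theorem CondB.le_of_mem_diagram {n : ℕ} {w : Equiv.Perm (Fin n)} {p q q' : ℕ}
    (hB : CondB w p q) (hD : (p, q') ∈ Diagram w) : q' ≤ q := by
  obtain ⟨-, -, hq1, hqn, hw, -⟩ := hD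
  by_contra! hlt
  exact hB ⟨q', hq1, hqn, hlt, hw⟩

/-- If `w` is defined by inclusions and `(p,q) ≠ (p′,q′)` are two boxes of the essential
set with positive rank, then either `p < p′ ∧ q < q′` or `p > p′ ∧ q > q′`. -/
theorem essential_boxes_nw_se_of_definedByInclusions {n : ℕ} (w : Equiv.Perm (Fin n))
    (hw : DefinedByInclusions w) {p q p' q' : ℕ}
    (h1 : (p, q) ∈ EssSet w) (hr1 : 0 < rk w p q)
    (h2 : (p', q') ∈ EssSet w) (hr2 : 0 < rk w p' q')
    (hne : (p, q) ≠ (p', q')) :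
    (p < p' ∧ q < q') ∨ (p' < p ∧ q' < q) := by
  have hB1 := (hw p q h1).resolve_left (not_condA_of_rk_pos hr1)
  have hB2 := (hw p' q' h2).resolve_left (not_condA_of_rk_pos hr2)
  rcases lt_trichotomy p p' with hlt | rfl | hgt
  · exact .inl ⟨hlt, hB2.lt_of_lt h1.1 hlt⟩
  · exact absurd (congrArg (Prod.mk p)
      ((hB2.le_of_mem_diagram h1.1).antisymm (hB1.le_of_mem_diagram h2.1))) hne
  · exact .inr ⟨hgt, hB1.lt_of_lt h2.1 hgt⟩
end
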